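/- Let (x,y,z) and (r,s,t) be bases of the space of linear forms in ℂ[X,Y,Z], let Φ = [[−y, x, 0], [−z, 0, x], [0, −z, y]] and Ψ = [[−s, −t, 0], [r, 0, −t], [0, r, s]]. Let α be a 2×3 complex matrix of rank 2 and β a 3×2 complex matrix of rank 2, and set φ₁₁ = α·Φ and φ₂₂ = Ψ·β. Then the ℂ-vector space of pairs (u,v), with u a 2×3 matrix of linear forms and v a 3×2 matrix of linear forms, satisfying v·φ₁₁ + φ₂₂·u = 0, has dimension 4. -/

import Mathlib

open MvPolynomial

abbrev R3 := MvPolynomial (Fin 3) ℂ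

/-- The Koszul matrix `Φ` associated to a triple of linear forms `(x,y,z)`. -/
noncomputable def PhiM (x y z : R3) : Matrix (Fin 3) (Fin 3) R3 :=
  !![-y, x, 0; -z, 0, x; 0, -z, y]

/-- The Koszul matrix `Ψ` associated to a triple of linear forms `(r,s,t)`. -/
noncomputable def PsiM (r s t : R3) : Matrix (Fin 3) (Fin 3) R3 :=
  !![-s, -t, 0; r, 0, -t; 0, r, s]

/-- `(u,v)` is a solution: `u` is a 2×3 matrix of linear forms, `v` a 3×2 matrix of linear
forms, and `v·φ₁₁ + φ₂₂·u = 0`. -/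
def IsSol (φ₁₁ : Matrix (Fin 2) (Fin 3) R3) (φ₂₂ : Matrix (Fin 3) (Fin 2) R3)
    (p : Matrix (Fin 2) (Fin 3) R3 × Matrix (Fin 3) (Fin 2) R3) : Prop :=
  (∀ i j, (p.1 i j).IsHomogeneous 1) ∧ (∀ i j, (p.2 i j).IsHomogeneous 1) ∧
    p.2 * φ₁₁ + φ₂₂ * p.1 = 0

lemma span_form {x y z : R3}
    (hS : ∀ p : R3, p.IsHomogeneous 1 → p ∈ Submodule.span ℂ ({x, y, z} : Set R3))
    (p : R3) (hp : p.IsHomogeneous 1) : ∃ a b c : ℂ, p = C a * x + C b * y + C c * z := by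
  obtain ⟨a, b, c, h⟩ := Submodule.mem_span_triple.1 (hS p hp)
  exact ⟨a, b, c, by rw [← h]; simp [MvPolynomial.smul_eq_C_mul]⟩

lemma lin_form (p : R3) (hp : p.IsHomogeneous 1) :
    ∃ a : Fin 3 → ℂ, ∀ q, eval q p = ∑ i, a i * q i := by
  have h : p ∈ homogeneousSubmodule (Fin 3) ℂ 1 := hp
  rw [homogeneousSubmodule_one_eq_span_X, Submodule.mem_span_range_iff_exists_fun] at h
  obtain ⟨a, rfl⟩ := h
  exact ⟨a, fun q => by simp [MvPolynomial.smul_eq_C_mul]⟩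

lemma eval_surj {x y z : R3}
    (hx : x.IsHomogeneous 1) (hy : y.IsHomogeneous 1) (hz : z.IsHomogeneous 1)
    (hS : ∀ p : R3, p.IsHomogeneous 1 → p ∈ Submodule.span ℂ ({x, y, z} : Set R3))
    (a b c : ℂ) : ∃ q : Fin 3 → ℂ, eval q x = a ∧ eval q y = b ∧ eval q z = c := by
  obtain ⟨f, hf⟩ := lin_form x hx
  obtain ⟨g, hg⟩ := lin_form y hy
  obtain ⟨h, hh⟩ := lin_form z hz
  let L : (Fin 3 → ℂ) →ₗ[ℂ] (Fin 3 → ℂ) := Matrix.mulVecLin (Matrix.of ![f, g, h])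
  have hL : ∀ q, L q = ![eval q x, eval q y, eval q z] := by
    intro q
    ext i
    fin_cases i <;> simp [L, hf, hg, hh, Matrix.mulVec, dotProduct]
  have hinj : Function.Injective L := by
    intro q q' he
    rw [hL, hL] at he
    have e0 := congrFun he 0
    have e1 := congrFun he 1
    have e2 := congrFun he 2
    simp at e0 e1 e2
    ext i
    obtain ⟨a, b, c, h⟩ := span_form hS (X i) (isHomogeneous_X _ _)
    have h1 := congrArg (eval q) h
    have h2 := congrArg (eval q') h
    simp at h1 h2
    rw [h1, h2, e0, e1, e2]
  obtain ⟨q, hq⟩ := LinearMap.injective_iff_surjective.1 hinj ![a, b, c]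
  rw [hL] at hq
  exact ⟨q, congrFun hq 0, congrFun hq 1, congrFun hq 2⟩

/-- evaluation of the triple is onto, and the triple spans the linear forms -/
def GoodT (x y z : R3) : Prop :=
  (∀ a b c : ℂ, ∃ q : Fin 3 → ℂ, eval q x = a ∧ eval q y = b ∧ eval q z = c) ∧
  (∀ p : R3, p.IsHomogeneous 1 → ∃ a b c : ℂ, p = C a * x + C b * y + C c * z)

lemma GoodT.indep {x y z : R3} (h : GoodT x y z) {a b c : ℂ}
    (e : C a * x + C b * y + C c * z = 0) : a = 0 ∧ b = 0 ∧ c = 0 := by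
  refine ⟨?_, ?_, ?_⟩
  · obtain ⟨q, h1, h2, h3⟩ := h.1 1 0 0
    simpa [h1, h2, h3] using congrArg (eval q) e
  · obtain ⟨q, h1, h2, h3⟩ := h.1 0 1 0
    simpa [h1, h2, h3] using congrArg (eval q) e
  · obtain ⟨q, h1, h2, h3⟩ := h.1 0 0 1
    simpa [h1, h2, h3] using congrArg (eval q) e

lemma GoodT.koszul {x y z : R3} (h : GoodT x y z) {a b c : R3}
    (ha : a.IsHomogeneous 1) (hb : b.IsHomogeneous 1) (hc : c.IsHomogeneous 1)
    (e : a * x + b * y + c * z = 0) :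
    ∃ m : Fin 3 → ℂ, a = -(C (m 0) * y) - C (m 1) * z ∧ b = C (m 0) * x - C (m 2) * z ∧
      c = C (m 1) * x + C (m 2) * y := by
  obtain ⟨a1, a2, a3, rfl⟩ := h.2 a ha
  obtain ⟨b1, b2, b3, rfl⟩ := h.2 b hb
  obtain ⟨c1, c2, c3, rfl⟩ := h.2 c hc
  have key : ∀ X Y Z : ℂ, (a1 * X + a2 * Y + a3 * Z) * X + (b1 * X + b2 * Y + b3 * Z) * Y +
      (c1 * X + c2 * Y + c3 * Z) * Z = 0 := by
    intro X Y Z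
    obtain ⟨q, h1, h2, h3⟩ := h.1 X Y Z
    simpa [h1, h2, h3] using congrArg (eval q) e
  have k1 : a1 = 0 := by linear_combination key 1 0 0
  have k2 : b2 = 0 := by linear_combination key 0 1 0
  have k3 : c3 = 0 := by linear_combination key 0 0 1
  have k4 : a2 = -b1 := by linear_combination key 1 1 0 - k1 - k2
  have k5 : a3 = -c1 := by linear_combination key 1 0 1 - k1 - k3
  have k6 : b3 = -c2 := by linear_combination key 0 1 1 - k2 - k3
  subst k1 k2 k3 k4 k5 k6
  refine ⟨![b1, c1, c2], ?_, ?_, ?_⟩ <;> simp <;> ring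

lemma GoodT.prop {x y z : R3} (h : GoodT x y z) {a b c : R3}
    (ha : a.IsHomogeneous 1) (hb : b.IsHomogeneous 1) (hc : c.IsHomogeneous 1)
    (e1 : a * y = b * x) (e2 : a * z = c * x) (e3 : b * z = c * y) :
    ∃ m : ℂ, a = C m * x ∧ b = C m * y ∧ c = C m * z := by
  obtain ⟨a1, a2, a3, rfl⟩ := h.2 a ha
  obtain ⟨b1, b2, b3, rfl⟩ := h.2 b hb
  obtain ⟨c1, c2, c3, rfl⟩ := h.2 c hc
  have key : ∀ X Y Z : ℂ, (a1 * X + a2 * Y + a3 * Z) * Y = (b1 * X + b2 * Y + b3 * Z) * X ∧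
      (a1 * X + a2 * Y + a3 * Z) * Z = (c1 * X + c2 * Y + c3 * Z) * X ∧
      (b1 * X + b2 * Y + b3 * Z) * Z = (c1 * X + c2 * Y + c3 * Z) * Y := by
    intro X Y Z
    obtain ⟨q, h1, h2, h3⟩ := h.1 X Y Z
    exact ⟨by simpa [h1, h2, h3] using congrArg (eval q) e1,
      by simpa [h1, h2, h3] using congrArg (eval q) e2,
      by simpa [h1, h2, h3] using congrArg (eval q) e3⟩
  have k1 : b1 = 0 := by linear_combination -(key 1 0 0).1
  have k2 : c1 = 0 := by linear_combination -(key 1 0 0).2.1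
  have k3 : a2 = 0 := by linear_combination (key 0 1 0).1
  have k4 : c2 = 0 := by linear_combination -(key 0 1 0).2.2
  have k5 : a3 = 0 := by linear_combination (key 0 0 1).2.1
  have k6 : b3 = 0 := by linear_combination (key 0 0 1).2.2
  subst k1 k2 k3 k4 k5 k6
  have k7 : b2 = a1 := by linear_combination -(key 1 1 0).1
  have k8 : c3 = a1 := by linear_combination -(key 1 0 1).2.1
  subst k7 k8
  exact ⟨c3, by simp, by simp, by simp⟩

/-- constants into polynomials, matrixwise -/
noncomputable abbrev CM {m n : ℕ} (A : Matrix (Fin m) (Fin n) ℂ) : Matrix (Fin m) (Fin n) R3 :=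
  A.map (fun c => (C c : R3))

lemma CM_mul {l m n : ℕ} (A : Matrix (Fin l) (Fin m) ℂ) (B : Matrix (Fin m) (Fin n) ℂ) :
    CM (A * B) = CM A * CM B := Matrix.map_mul (f := (C : ℂ →+* R3))

lemma CM_one {n : ℕ} : CM (1 : Matrix (Fin n) (Fin n) ℂ) = 1 := by
  exact Matrix.map_one _ (map_zero C) (map_one C)

lemma CM_add {m n : ℕ} (A B : Matrix (Fin m) (Fin n) ℂ) : CM (A + B) = CM A + CM B := by
  ext; simp [CM]

lemma CM_neg {m n : ℕ} (A : Matrix (Fin m) (Fin n) ℂ) : CM (-A) = -CM A := by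
  ext; simp [CM]

lemma psi_eq (r s t : R3) : PsiM r s t = (PhiM r s t).transpose := by
  ext i j
  fin_cases i <;> fin_cases j <;> simp [PsiM, PhiM]

/-- A constant matrix killed by `Φ` on the right vanishes. -/
lemma GoodT.const_phi {x y z : R3} (h : GoodT x y z) {n : ℕ} (K : Matrix (Fin n) (Fin 3) ℂ)
    (e : CM K * PhiM x y z = 0) : K = 0 := by
  ext i j
  have e0 := congrFun (congrFun e i) 0
  have e1 := congrFun (congrFun e i) 1
  simp [Matrix.mul_apply, Fin.sum_univ_three, PhiM, CM] at e0 e1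
  have i0 := h.indep (a := 0) (b := -K i 0) (c := -K i 1) (by simp; linear_combination e0)
  have i1 := h.indep (a := K i 0) (b := 0) (c := -K i 2) (by simp; linear_combination e1)
  fin_cases j
  · simpa using i1.1
  · simpa using i0.2.2
  · simpa using i1.2.2

lemma GoodT.koszulM {x y z : R3} (h : GoodT x y z) {n : ℕ} (u : Matrix (Fin n) (Fin 3) R3)
    (hu : ∀ i j, (u i j).IsHomogeneous 1) (e : u.mulVec ![x, y, z] = 0) :
    ∃ M : Matrix (Fin n) (Fin 3) ℂ, u = CM M * PhiM x y z := by
  have : ∀ i, ∃ m : Fin 3 → ℂ, u i 0 = -(C (m 0) * y) - C (m 1) * z ∧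
      u i 1 = C (m 0) * x - C (m 2) * z ∧ u i 2 = C (m 1) * x + C (m 2) * y := by
    intro i
    apply h.koszul (hu i 0) (hu i 1) (hu i 2)
    have := congrFun e i
    simpa [Matrix.mulVec, dotProduct, Fin.sum_univ_three] using this
  choose M hM using this
  refine ⟨Matrix.of M, ?_⟩
  ext1 i j
  obtain ⟨h0, h1, h2⟩ := hM i
  fin_cases j
  · simp [h0, Matrix.mul_apply, Fin.sum_univ_three, PhiM, CM]; ring
  · simp [h1, Matrix.mul_apply, Fin.sum_univ_three, PhiM, CM]; ring
  · simp [h2, Matrix.mul_apply, Fin.sum_univ_three, PhiM, CM]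

lemma phi_mulVec (x y z : R3) : (PhiM x y z).mulVec ![x, y, z] = 0 := by
  ext1 i
  fin_cases i <;> simp [PhiM, Matrix.mulVec, dotProduct, Fin.sum_univ_three] <;> ring

/-- kernel relations for `Ψ` -/
lemma psi_ker {r s t : R3} {w : Fin 3 → R3} (e : (PsiM r s t).mulVec w = 0) :
    w 0 * -s = w 1 * t ∧ w 0 * r = w 2 * t ∧ w 1 * r = w 2 * -s := by
  have e0 := congrFun e 0
  have e1 := congrFun e 1
  have e2 := congrFun e 2
  simp [PsiM, Matrix.mulVec, dotProduct, Fin.sum_univ_three] at e0 e1 e2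
  refine ⟨?_, ?_, ?_⟩
  · linear_combination e0
  · linear_combination e1
  · linear_combination e2

lemma rank_facts (α : Matrix (Fin 2) (Fin 3) ℂ) (hα : α.rank = 2) :
    (∃ α' : Matrix (Fin 3) (Fin 2) ℂ, α * α' = 1) ∧ ∃ d : Fin 3 → ℂ, d ≠ 0 ∧ α.mulVec d = 0 := by
  constructor
  · rw [← Matrix.mulVec_surjective_iff_exists_right_inverse]
    have : LinearMap.range α.mulVecLin = ⊤ := by
      apply Submodule.eq_top_of_finrank_eq
      rw [← Matrix.rank, hα]; simp
    exact LinearMap.range_eq_top.1 this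
  · have : LinearMap.ker α.mulVecLin ≠ ⊥ := LinearMap.ker_ne_bot_of_finrank_lt (by simp)
    obtain ⟨d, hd, h0⟩ := Submodule.exists_mem_ne_zero_of_ne_bot this
    exact ⟨d, h0, hd⟩

/-- `Ψ β` is injective. -/
lemma GoodT.psi_beta_inj {r s t : R3} (h : GoodT r s t) (α : Matrix (Fin 2) (Fin 3) ℂ)
    (hα : α.rank = 2) (f : Fin 2 → R3)
    (e : (PsiM r s t * CM α.transpose).mulVec f = 0) : f = 0 := by
  obtain ⟨⟨α', ha⟩, d, hd, h0⟩ := rank_facts α hα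
  rw [← Matrix.mulVec_mulVec] at e
  set w := (CM α.transpose).mulVec f with hw
  obtain ⟨e1, e2, e3⟩ := psi_ker e
  have hdw : C (d 0) * w 0 + C (d 1) * w 1 + C (d 2) * w 2 = 0 := by
    have z0 := congrArg (C : ℂ → R3) (congrFun h0 0)
    have z1 := congrArg (C : ℂ → R3) (congrFun h0 1)
    simp [Matrix.mulVec, dotProduct, Fin.sum_univ_three] at z0 z1
    simp [hw, Matrix.mulVec, dotProduct, CM]
    linear_combination f 0 * z0 + f 1 * z1
  have hne : C (d 0) * t + C (d 1) * -s + C (d 2) * r ≠ 0 := by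
    intro hz
    obtain ⟨i1, i2, i3⟩ := h.indep (a := d 2) (b := -d 1) (c := d 0)
      (by simp; linear_combination hz)
    apply hd
    ext i
    fin_cases i
    · exact i3
    · simpa using i2
    · exact i1
  have w0 : w = 0 := by
    ext1 i
    have : w i * (C (d 0) * t + C (d 1) * -s + C (d 2) * r) = 0 := by
      fin_cases i
      · simp only [Fin.zero_eta, Fin.mk_one, Fin.reduceFinMk, Fin.isValue]
        linear_combination t * hdw + C (d 1) * e1 + C (d 2) * e2
      · simp only [Fin.zero_eta, Fin.mk_one, Fin.reduceFinMk, Fin.isValue]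
        linear_combination -s * hdw - C (d 0) * e1 + C (d 2) * e3
      · simp only [Fin.zero_eta, Fin.mk_one, Fin.reduceFinMk, Fin.isValue]
        linear_combination r * hdw - C (d 0) * e2 - C (d 1) * e3
    exact (mul_eq_zero.1 this).resolve_right hne
  have : (CM α'.transpose).mulVec w = f := by
    rw [hw, Matrix.mulVec_mulVec, ← CM_mul, ← Matrix.transpose_mul, ha, Matrix.transpose_one,
      CM_one, Matrix.one_mulVec]
  rw [← this, w0, Matrix.mulVec_zero]

lemma hom_CM_mul {l m n : ℕ} (A : Matrix (Fin l) (Fin m) ℂ) (P : Matrix (Fin m) (Fin n) R3)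
    (hP : ∀ i j, (P i j).IsHomogeneous 1) (i j) : ((CM A * P) i j).IsHomogeneous 1 := by
  rw [Matrix.mul_apply]
  exact IsHomogeneous.sum _ _ _ fun k _ => (hP k j).C_mul (A i k)

lemma hom_mul_CM {l m n : ℕ} (A : Matrix (Fin m) (Fin n) ℂ) (P : Matrix (Fin l) (Fin m) R3)
    (hP : ∀ i j, (P i j).IsHomogeneous 1) (i j) : ((P * CM A) i j).IsHomogeneous 1 := by
  rw [Matrix.mul_apply]
  exact IsHomogeneous.sum _ _ _ fun k _ => by
    rw [mul_comm]; exact (hP i k).C_mul (A k j)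

lemma hom_phi {x y z : R3} (hx : x.IsHomogeneous 1) (hy : y.IsHomogeneous 1)
    (hz : z.IsHomogeneous 1) (i j) : (PhiM x y z i j).IsHomogeneous 1 := by
  fin_cases i <;> fin_cases j <;>
    simp [PhiM, hx, hy, hz, hx.neg, hy.neg, hz.neg, isHomogeneous_zero]

/-- `Ψ K Φ = 0` forces `K = 0`. -/
lemma sandwich {x y z r s t : R3} (h : GoodT x y z) (h' : GoodT t (-s) r)
    (hx : x.IsHomogeneous 1) (hy : y.IsHomogeneous 1) (hz : z.IsHomogeneous 1)
    (K : Matrix (Fin 3) (Fin 3) ℂ)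
    (e : PsiM r s t * (CM K * PhiM x y z) = 0) : K = 0 := by
  apply h.const_phi
  set W := CM K * PhiM x y z with hW
  have hom : ∀ i j, (W i j).IsHomogeneous 1 := hom_CM_mul K _ (hom_phi hx hy hz)
  have hWX : W.mulVec ![x, y, z] = 0 := by
    rw [hW, ← Matrix.mulVec_mulVec, phi_mulVec, Matrix.mulVec_zero]
  have : ∀ k, ∃ m : ℂ, W 0 k = C m * t ∧ W 1 k = C m * -s ∧ W 2 k = C m * r := by
    intro k
    have ek : (PsiM r s t).mulVec (fun i => W i k) = 0 := by
      ext1 i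
      have := congrFun (congrFun e i) k
      simpa [Matrix.mul_apply, Matrix.mulVec, dotProduct] using this
    obtain ⟨e1, e2, e3⟩ := psi_ker ek
    exact h'.prop (hom _ _) (hom _ _) (hom _ _) e1 e2 e3
  choose m hm using this
  have ht : t ≠ 0 := by
    rintro rfl
    obtain ⟨q, h1, _⟩ := h'.1 1 0 0
    simp at h1
  have h0 := congrFun hWX 0
  simp [Matrix.mulVec, dotProduct, Fin.sum_univ_three, (hm _).1] at h0
  have h1 : t * (C (m 0) * x + C (m 1) * y + C (m 2) * z) = 0 := by linear_combination h0
  obtain ⟨m0, m1, m2⟩ := h.indep ((mul_eq_zero.1 h1).resolve_left ht)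
  have mm : ∀ k, m k = 0 := by intro k; fin_cases k <;> assumption
  ext1 i k
  obtain ⟨a, b, c⟩ := hm k
  fin_cases i <;> simp [a, b, c, mm]

lemma goodT_of {x y z : R3}
    (hx : x.IsHomogeneous 1) (hy : y.IsHomogeneous 1) (hz : z.IsHomogeneous 1)
    (hS : ∀ p : R3, p.IsHomogeneous 1 → p ∈ Submodule.span ℂ ({x, y, z} : Set R3)) :
    GoodT x y z := ⟨eval_surj hx hy hz hS, span_form hS⟩

lemma GoodT.swap {r s t : R3} (h : GoodT r s t) : GoodT t (-s) r := by
  constructor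
  · intro a b c
    obtain ⟨q, h1, h2, h3⟩ := h.1 c (-b) a
    exact ⟨q, h3, by simp [h2], h1⟩
  · intro p hp
    obtain ⟨a, b, c, rfl⟩ := h.2 p hp
    exact ⟨c, -b, a, by simp; ring⟩

/-- The classification of solutions. -/
lemma classify {x y z r s t : R3}
    (hx : x.IsHomogeneous 1) (hy : y.IsHomogeneous 1) (hz : z.IsHomogeneous 1)
    (h : GoodT x y z) (h' : GoodT r s t)
    (α : Matrix (Fin 2) (Fin 3) ℂ) (β : Matrix (Fin 3) (Fin 2) ℂ)
    (hα : α.rank = 2) (hβ : β.rank = 2)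
    (u : Matrix (Fin 2) (Fin 3) R3) (v : Matrix (Fin 3) (Fin 2) R3)
    (hu : ∀ i j, (u i j).IsHomogeneous 1) (hv : ∀ i j, (v i j).IsHomogeneous 1)
    (e : v * (CM α * PhiM x y z) + (PsiM r s t * CM β) * u = 0) :
    ∃ M : Matrix (Fin 2) (Fin 2) ℂ, u = CM M * (CM α * PhiM x y z) ∧
      v = -((PsiM r s t * CM β) * CM M) := by
  have hβ' : β.transpose.rank = 2 := by rw [Matrix.rank_transpose, hβ]
  have u0 : u.mulVec ![x, y, z] = 0 := by
    apply h'.psi_beta_inj β.transpose hβ'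
    rw [Matrix.transpose_transpose, Matrix.mulVec_mulVec]
    have := congrArg (fun P => Matrix.mulVec P ![x, y, z]) e
    simpa [Matrix.add_mulVec, ← Matrix.mulVec_mulVec, phi_mulVec] using this
  have v0 : v.transpose.mulVec ![r, s, t] = 0 := by
    apply h.psi_beta_inj α hα
    rw [psi_eq, Matrix.mulVec_mulVec]
    have := congrArg (fun P => Matrix.mulVec (Matrix.transpose P) ![r, s, t]) e
    simpa [psi_eq, Matrix.add_mulVec, ← Matrix.mulVec_mulVec, phi_mulVec, Matrix.transpose_mul,
      Matrix.transpose_map] using this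
  obtain ⟨M, hM⟩ := h.koszulM u hu u0
  obtain ⟨N, hN⟩ := h'.koszulM v.transpose (fun i j => hv j i) v0
  have hN' : v = PsiM r s t * CM N.transpose := by
    rw [← Matrix.transpose_transpose v, hN, Matrix.transpose_mul, psi_eq]; rfl
  have K0 : N.transpose * α + β * M = 0 := by
    apply sandwich h h'.swap hx hy hz
    rw [← e, hN', hM, CM_add, CM_mul, CM_mul]
    simp only [Matrix.mul_add, Matrix.add_mul, Matrix.mul_assoc]
  obtain ⟨⟨α', ha⟩, -⟩ := rank_facts α hα
  obtain ⟨⟨β', hb⟩, -⟩ := rank_facts _ hβ'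
  have hb' : β'.transpose * β = 1 := by
    have := congrArg Matrix.transpose hb
    simpa [Matrix.transpose_mul] using this
  have hNe : N.transpose = -(β * (M * α')) := by
    have := congrArg (· * α') K0
    simp only [Matrix.add_mul, Matrix.mul_assoc, ha, Matrix.mul_one, Matrix.zero_mul] at this
    exact eq_neg_of_add_eq_zero_left this
  have hMe : M = M * α' * α := by
    have := congrArg (β'.transpose * ·) K0
    rw [hNe] at this
    simp only [Matrix.mul_add, ← Matrix.mul_assoc, hb', Matrix.one_mul, Matrix.mul_zero,
      Matrix.neg_mul, Matrix.mul_neg] at this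
    exact (neg_add_eq_zero.1 this).symm
  refine ⟨M * α', ?_, ?_⟩
  · rw [← Matrix.mul_assoc, ← CM_mul, ← hMe, hM]
  · rw [hN', hNe, CM_neg, CM_mul, Matrix.mul_neg, Matrix.mul_assoc]

/-- The parametrization of the solutions. -/
noncomputable def solMap (φ₁₁ : Matrix (Fin 2) (Fin 3) R3) (φ₂₂ : Matrix (Fin 3) (Fin 2) R3) :
    Matrix (Fin 2) (Fin 2) ℂ →ₗ[ℂ] Matrix (Fin 2) (Fin 3) R3 × Matrix (Fin 3) (Fin 2) R3 where
  toFun M := (CM M * φ₁₁, -(φ₂₂ * CM M))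
  map_add' A B := by
    simp only [CM_add, Matrix.add_mul, Matrix.mul_add, neg_add, Prod.mk_add_mk]
  map_smul' c A := by
    have : CM (c • A) = c • CM A := by
      ext1 i j
      simp [CM, MvPolynomial.smul_eq_C_mul]
    simp only [this, Matrix.smul_mul, Matrix.mul_smul, RingHom.id_apply, Prod.smul_mk, smul_neg]

/-- Let `(x,y,z)`, `(r,s,t)` be bases of the linear forms, `Φ`, `Ψ` the Koszul matrices,
`α` a constant 2×3 matrix of rank 2, `β` a constant 3×2 matrix of rank 2, and set
`φ₁₁ = α·Φ`, `φ₂₂ = Ψ·β`.  Then the space of pairs `(u,v)` of matrices of linear forms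
with `v·φ₁₁ + φ₂₂·u = 0` has dimension 4 over `ℂ`. -/
theorem stmt7 (x y z r s t : R3)
    (hx : x.IsHomogeneous 1) (hy : y.IsHomogeneous 1) (hz : z.IsHomogeneous 1)
    (hr : r.IsHomogeneous 1) (hs : s.IsHomogeneous 1) (ht : t.IsHomogeneous 1)
    (hI₁ : LinearIndependent ℂ ![x, y, z]) (hI₂ : LinearIndependent ℂ ![r, s, t])
    (hS₁ : ∀ p : R3, p.IsHomogeneous 1 → p ∈ Submodule.span ℂ ({x, y, z} : Set R3))
    (hS₂ : ∀ p : R3, p.IsHomogeneous 1 → p ∈ Submodule.span ℂ ({r, s, t} : Set R3))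
    (α : Matrix (Fin 2) (Fin 3) ℂ) (β : Matrix (Fin 3) (Fin 2) ℂ)
    (hα : α.rank = 2) (hβ : β.rank = 2) :
    ∃ bas : Fin 4 → Matrix (Fin 2) (Fin 3) R3 × Matrix (Fin 3) (Fin 2) R3,
      LinearIndependent ℂ bas ∧
      (∀ k, IsSol (α.map (fun c => (C c : R3)) * PhiM x y z)
        (PsiM r s t * β.map (fun c => (C c : R3))) (bas k)) ∧
      ∀ p, IsSol (α.map (fun c => (C c : R3)) * PhiM x y z)
        (PsiM r s t * β.map (fun c => (C c : R3))) p →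
        p ∈ Submodule.span ℂ (Set.range bas) := by
  have h := goodT_of hx hy hz hS₁
  have h' := goodT_of hr hs ht hS₂
  let T := solMap (α.map (fun c => (C c : R3)) * PhiM x y z)
    (PsiM r s t * β.map (fun c => (C c : R3)))
  have hT : LinearMap.ker T = ⊥ := by
    rw [LinearMap.ker_eq_bot']
    intro M hM
    have h1 : CM M * (CM α * PhiM x y z) = 0 := congrArg Prod.fst hM
    rw [← Matrix.mul_assoc, ← CM_mul] at h1
    have h2 := h.const_phi _ h1
    obtain ⟨⟨α', ha⟩, -⟩ := rank_facts α hα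
    rw [← Matrix.mul_one M, ← ha, ← Matrix.mul_assoc, h2, Matrix.zero_mul]
  let b : Module.Basis (Fin 4) ℂ (Matrix (Fin 2) (Fin 2) ℂ) :=
    (Matrix.stdBasis ℂ (Fin 2) (Fin 2)).reindex (finProdFinEquiv (m := 2) (n := 2))
  refine ⟨fun k => T (b k), b.linearIndependent.map' T hT, ?_, ?_⟩
  · intro k
    refine ⟨?_, ?_, ?_⟩
    · exact hom_CM_mul _ _ (hom_CM_mul _ _ (hom_phi hx hy hz))
    · intro i j
      refine (hom_mul_CM _ _ (hom_mul_CM _ _ ?_) i j).neg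
      rw [psi_eq]
      exact fun i j => hom_phi hr hs ht j i
    · simp only [T, solMap, LinearMap.coe_mk, AddHom.coe_mk, Matrix.neg_mul, Matrix.mul_assoc]
      exact neg_add_cancel _
  · rintro ⟨u, v⟩ ⟨hu, hv, e⟩
    obtain ⟨M, hM, hM'⟩ := classify hx hy hz h h' α β hα hβ u v hu hv e
    have hr : Set.range (fun k => T (b k)) = T '' Set.range b := by
      rw [← Set.range_comp]; rfl
    rw [hr, Submodule.span_image, b.span_eq]
    exact ⟨M, trivial, Prod.ext hM.symm hM'.symm⟩
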